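/- arXiv:2311.14121 — 2 statements merged into one kernel-verified Lean document; each statement's English description precedes it below -/
import Mathlib

section
/- Let A : ℝ → Matrix (Fin n) (Fin n) ℝ be measurable and bounded and let Φ_A be its fundamental matrix. Then Φ_A satisfies the cocycle (flow) property: for all t, r, s ∈ ℝ, Φ_A(t, r) · Φ_A(r, s) = Φ_A(t, s). -/
open MeasureTheory

/-- Forward integral Grönwall inequality with zero initial value. -/
lemma eq_zero_of_le_mul_integral {g : ℝ → ℝ} (hg : Continuous g) (hg0 : ∀ t, 0 ≤ g t)
    {K r : ℝ} (h : ∀ t, r ≤ t → g t ≤ K * ∫ τ in r..t, g τ) {t : ℝ} (ht : r ≤ t) : g t = 0 := by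
  have hderiv : ∀ x, HasDerivAt (fun u => ∫ τ in r..u, g τ) (g x) x := fun x =>
    intervalIntegral.integral_hasDerivAt_right (hg.intervalIntegrable _ _)
      (hg.stronglyMeasurableAtFilter _ _) hg.continuousAt
  have hbound := norm_le_gronwallBound_of_norm_deriv_right_le
    (f := fun u => ∫ τ in r..u, g τ) (f' := g) (δ := 0) (K := K) (ε := 0) (a := r) (b := t)
    (fun x _ => (hderiv x).continuousAt.continuousWithinAt)
    (fun x _ => (hderiv x).hasDerivWithinAt) (by simp)
    (fun x hx => by
      rw [Real.norm_of_nonneg (hg0 x),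
        Real.norm_of_nonneg (intervalIntegral.integral_nonneg hx.1 fun u _ => hg0 u), add_zero]
      exact h x hx.1)
    t ⟨ht, le_rfl⟩
  have hzero : ∫ τ in r..t, g τ = 0 := by
    simpa [gronwallBound_ε0_δ0] using hbound
  have := h t ht
  rw [hzero, mul_zero] at this
  exact le_antisymm this (hg0 t)

/-- Two-sided integral Grönwall inequality with zero initial value. -/
lemma eq_zero_of_le_mul_abs_integral {g : ℝ → ℝ} (hg : Continuous g) (hg0 : ∀ t, 0 ≤ g t)
    {K r : ℝ} (h : ∀ t, g t ≤ K * |∫ τ in r..t, g τ|) (t : ℝ) : g t = 0 := by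
  rcases le_total r t with ht | ht
  · refine eq_zero_of_le_mul_integral hg hg0 (K := K) (fun u hu => ?_) ht
    simpa [abs_of_nonneg (intervalIntegral.integral_nonneg hu fun x _ => hg0 x)] using h u
  · have hneg := eq_zero_of_le_mul_integral (g := fun x => g (-x)) (K := K) (r := -r) (t := -t)
      (hg.comp continuous_neg) (fun x => hg0 (-x)) (fun u hu => ?_) (neg_le_neg ht)
    · simpa using hneg
    · have hu' : -u ≤ r := by linarith
      have := h (-u)
      rw [intervalIntegral.integral_symm, abs_neg,
        abs_of_nonneg (intervalIntegral.integral_nonneg hu' fun x _ => hg0 x)] at this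
      simpa [intervalIntegral.integral_comp_neg] using this

section LinearSystem

variable {ι κ : Type*} [Fintype ι] {A : ℝ → Matrix ι ι ℝ} {C : ℝ}

lemma intervalIntegrable_matrix_mul_apply (hA : ∀ i j, Measurable fun t => A t i j)
    (hC : ∀ t i j, |A t i j| ≤ C) {F : ℝ → Matrix ι κ ℝ}
    (hF : ∀ i j, Continuous fun t => F t i j) (i : ι) (j : κ) (a b : ℝ) :
    IntervalIntegrable (fun t => (A t * F t) i j) volume a b := by
  simp only [Matrix.mul_apply]
  have hterm : ∀ k, IntervalIntegrable (fun t => A t i k * F t k j) volume a b := fun k => by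
    have h_int := ((hF k j).intervalIntegrable (μ := volume) a b)
    rw [intervalIntegrable_iff] at h_int ⊢
    exact h_int.bdd_mul (c := C) (hA i k).aestronglyMeasurable
      (Filter.Eventually.of_forall fun t => hC t i k)
  simpa only [Finset.sum_fn, ← Finset.sum_apply] using
    IntervalIntegrable.sum Finset.univ fun k _ => hterm k

/-- The only continuous solution of the integral equation `D t = ∫_{r}^{t} A D` is zero. -/
lemma eq_zero_of_eq_integral_matrix_mul [Fintype κ] (hC : ∀ t i j, |A t i j| ≤ C)
    {D : ℝ → Matrix ι κ ℝ} (hD : ∀ i j, Continuous fun t => D t i j) {r : ℝ}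
    (h : ∀ t i j, D t i j = ∫ τ in r..t, (A τ * D τ) i j) (t : ℝ) : D t = 0 := by
  let g : ℝ → ℝ := fun t => ∑ i, ∑ j, |D t i j|
  have hg : Continuous g :=
    continuous_finsetSum _ fun i _ => continuous_finsetSum _ fun j _ => (hD i j).abs
  have hg0 : ∀ t, 0 ≤ g t := fun t => by positivity
  have hcol : ∀ t j, ∑ k, |D t k j| ≤ g t := fun t j =>
    Finset.sum_le_sum fun k _ =>
      Finset.single_le_sum (f := fun j => |D t k j|) (fun _ _ => abs_nonneg _) (Finset.mem_univ j)
  have hentry : ∀ t i j, |D t i j| ≤ |C| * |∫ τ in r..t, g τ| := fun t i j => by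
    have h_int : IntervalIntegrable (fun τ => |C| * g τ) volume r t :=
      (continuous_const.mul hg).intervalIntegrable _ _
    rw [h t i j, ← abs_abs C, ← abs_mul, ← intervalIntegral.integral_const_mul,
      ← Real.norm_eq_abs (∫ τ in r..t, (A τ * D τ) i j)]
    refine intervalIntegral.norm_integral_le_abs_of_norm_le
      (Filter.Eventually.of_forall fun τ => ?_) h_int
    rw [Matrix.mul_apply, Real.norm_eq_abs]
    calc |∑ k, A τ i k * D τ k j| ≤ ∑ k, |A τ i k * D τ k j| := Finset.abs_sum_le_sum_abs _ _
      _ ≤ ∑ k, |C| * |D τ k j| := Finset.sum_le_sum fun k _ => by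
          rw [abs_mul]
          exact mul_le_mul_of_nonneg_right ((hC τ i k).trans (le_abs_self C)) (abs_nonneg _)
      _ = |C| * ∑ k, |D τ k j| := (Finset.mul_sum ..).symm
      _ ≤ |C| * g τ := by gcongr; exact hcol τ j
  have hzero : g t = 0 := by
    refine eq_zero_of_le_mul_abs_integral hg hg0
      (K := Fintype.card ι * (Fintype.card κ * |C|)) (r := r) (fun u => ?_) t
    calc g u ≤ ∑ _i : ι, ∑ _j : κ, |C| * |∫ τ in r..u, g τ| :=
          Finset.sum_le_sum fun i _ => Finset.sum_le_sum fun j _ => hentry u i j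
      _ = _ := by simp [mul_assoc]
  ext i j
  have hij : |D t i j| ≤ g t :=
    (Finset.single_le_sum (f := fun k => |D t k j|) (fun _ _ => abs_nonneg _)
      (Finset.mem_univ i)).trans (hcol t j)
  rw [hzero] at hij
  simpa using hij

end LinearSystem

/-- The fundamental matrix `Φ_A` associated with a measurable bounded `A` satisfies the
cocycle (flow) property `Φ_A(t, r) · Φ_A(r, s) = Φ_A(t, s)` for all `t, r, s`. -/
theorem fundamental_matrix_cocycle
    (n : ℕ)
    (A : ℝ → Matrix (Fin n) (Fin n) ℝ)
    (hAmeas : ∀ i j, Measurable fun t => A t i j)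
    (hAbdd : ∃ C : ℝ, ∀ t i j, |A t i j| ≤ C)
    (Φ : ℝ → ℝ → Matrix (Fin n) (Fin n) ℝ)
    (hΦcont : ∀ s i j, Continuous fun t => Φ t s i j)
    (hΦeq : ∀ s t i j, Φ t s i j
        = (1 : Matrix (Fin n) (Fin n) ℝ) i j + ∫ r in s..t, (A r * Φ r s) i j) :
    ∀ t r s : ℝ, Φ t r * Φ r s = Φ t s := by
  obtain ⟨C, hC⟩ := hAbdd
  intro t r s
  have h_int : ∀ s i j a b, IntervalIntegrable (fun τ => (A τ * Φ τ s) i j) volume a b :=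
    fun s => intervalIntegrable_matrix_mul_apply hAmeas hC (hΦcont s)
  have hcont : ∀ i j, Continuous fun t => (Φ t r * Φ r s) i j := fun i j => by
    simp only [Matrix.mul_apply]
    exact continuous_finsetSum _ fun k _ => (hΦcont r i k).mul_const _
  have hleft : ∀ t i j, (Φ t r * Φ r s) i j
      = Φ r s i j + ∫ τ in r..t, (A τ * (Φ τ r * Φ r s)) i j := fun t i j => by
    have hprod : (∫ τ in r..t, (A τ * (Φ τ r * Φ r s)) i j)
        = ∑ k, (∫ τ in r..t, (A τ * Φ τ r) i k) * Φ r s k j := by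
      simp only [← Matrix.mul_assoc, Matrix.mul_apply (M := _ * _)]
      rw [intervalIntegral.integral_finsetSum fun k _ => (h_int r i k r t).mul_const _]
      simp only [intervalIntegral.integral_mul_const]
    rw [hprod, Matrix.mul_apply]
    simp only [hΦeq r t, add_mul, Finset.sum_add_distrib]
    rw [← Matrix.mul_apply, Matrix.one_mul]
  have hright : ∀ t i j, Φ t s i j = Φ r s i j + ∫ τ in r..t, (A τ * Φ τ s) i j :=
    fun t i j => by
      rw [hΦeq s t, hΦeq s r, add_assoc,
        intervalIntegral.integral_add_adjacent_intervals (h_int s i j s r) (h_int s i j r t)]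
  refine sub_eq_zero.mp (eq_zero_of_eq_integral_matrix_mul hC
    (D := fun t => Φ t r * Φ r s - Φ t s) (r := r)
    (fun i j => (hcont i j).sub (hΦcont s i j)) (fun t i j => ?_) t)
  simp only [Matrix.mul_sub, Matrix.sub_apply]
  rw [intervalIntegral.integral_sub
    (intervalIntegrable_matrix_mul_apply hAmeas hC hcont i j r t) (h_int s i j r t),
    hleft t, hright t, add_sub_add_left_eq_sub]
end

section
/- Variation of constants for linear Carathéodory ODEs: let A : ℝ → Matrix (Fin n) (Fin n) ℝ be measurable and bounded with fundamental matrix Φ_A, let f : ℝ → ℝⁿ be measurable and integrable on [t₀, t₁], and let x : ℝ → ℝⁿ be continuous with x(t) = x(t₀) + ∫_{t₀}^{t} (A(s) x(s) + f(s)) ds for all t ∈ [t₀, t₁]. Then for all t ∈ [t₀, t₁], x(t) = Φ_A(t, t₀) x(t₀) + ∫_{t₀}^{t} Φ_A(t, s) f(s) ds. -/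
open MeasureTheory

lemma eq_zero_of_norm_le_mul_integral_norm {E : Type*} [NormedAddCommGroup E]
    {φ : ℝ → E} {K a b : ℝ} (hφ : ContinuousOn φ (Set.Icc a b))
    (h : ∀ t ∈ Set.Icc a b, ‖φ t‖ ≤ K * ∫ r in a..t, ‖φ r‖) :
    ∀ t ∈ Set.Icc a b, φ t = 0 := by
  intro t ht
  have hab : a ≤ b := ht.1.trans ht.2
  set g : ℝ → ℝ := Set.IccExtend hab ((Set.Icc a b).domRestrict fun r => ‖φ r‖) with hg
  have hgc : Continuous g := by
    rw [hg, continuous_IccExtend_iff]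
    exact hφ.norm.domRestrict
  have hgφ : ∀ r ∈ Set.Icc a b, g r = ‖φ r‖ := fun r hr => by
    rw [hg, Set.IccExtend_of_mem _ _ hr]; rfl
  have hint : ∀ r ∈ Set.Icc a b, ∫ s in a..r, ‖φ s‖ = ∫ s in a..r, g s := fun r hr => by
    refine intervalIntegral.integral_congr fun s hs => ?_
    rw [Set.uIcc_of_le hr.1] at hs
    exact (hgφ s ⟨hs.1, hs.2.trans hr.2⟩).symm
  have hderiv : ∀ r, HasDerivAt (fun r => ∫ s in a..r, g s) (g r) r := fun r =>
    (hgc.integral_hasStrictDerivAt a r).hasDerivAt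
  have hle : ∀ r ∈ Set.Icc a b, g r ≤ K * ∫ s in a..r, g s := fun r hr => by
    rw [hgφ r hr, ← hint r hr]
    exact h r hr
  have hzero := eq_zero_of_abs_deriv_le_mul_abs_self_of_eq_zero_right (K := |K|)
    (f := fun r => ∫ s in a..r, g s) (f' := g) (a := a) (b := b)
    (fun r _ => (hderiv r).continuousAt.continuousWithinAt)
    (fun r _ => (hderiv r).hasDerivWithinAt) (by simp)
    (fun r hr => by
      have hr' := Set.Ico_subset_Icc_self hr
      rw [Real.norm_of_nonneg ((norm_nonneg _).trans_eq (hgφ r hr').symm), Real.norm_eq_abs,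
        ← abs_mul]
      exact (hle r hr').trans (le_abs_self _)) t ht
  have := h t ht
  rw [hint t ht, hzero, mul_zero] at this
  exact norm_le_zero_iff.mp this

section Caratheodory

variable {n : ℕ} {A : ℝ → Matrix (Fin n) (Fin n) ℝ}

lemma intervalIntegrable_of_measurable_of_abs_le {g : ℝ → ℝ} {C : ℝ}
    (hg : Measurable g) (hC : ∀ t, |g t| ≤ C) (a b : ℝ) :
    IntervalIntegrable g volume a b :=
  (intervalIntegrable_const (c := C)).mono_fun hg.aestronglyMeasurable
    (Filter.Eventually.of_forall fun t => (hC t).trans (le_abs_self C))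

lemma intervalIntegrable_mulVec_apply {a b : ℝ}
    (hA : ∀ i j, IntervalIntegrable (fun t => A t i j) volume a b) {w : ℝ → Fin n → ℝ}
    (hw : ∀ i, ContinuousOn (fun t => w t i) (Set.uIcc a b)) (i : Fin n) :
    IntervalIntegrable (fun t => (A t).mulVec (w t) i) volume a b := by
  simp only [Matrix.mulVec, dotProduct]
  have := IntervalIntegrable.sum (μ := volume) (a := a) (b := b) Finset.univ
    (f := fun j t => A t i j * w t j) fun j _ => (hA i j).mul_continuousOn (hw j)
  simpa only [Finset.sum_fn] using this

lemma intervalIntegrable_mulVec_apply_of_continuousOn {a b : ℝ}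
    (hA : ∀ i j, ContinuousOn (fun t => A t i j) (Set.uIcc a b)) {w : ℝ → Fin n → ℝ}
    (hw : ∀ i, IntervalIntegrable (fun t => w t i) volume a b) (i : Fin n) :
    IntervalIntegrable (fun t => (A t).mulVec (w t) i) volume a b := by
  simp only [Matrix.mulVec, dotProduct]
  have := IntervalIntegrable.sum (μ := volume) (a := a) (b := b) Finset.univ
    (f := fun j t => A t i j * w t j) fun j _ => (hw j).continuousOn_mul (hA i j)
  simpa only [Finset.sum_fn] using this

lemma intervalIntegral_apply {g : ℝ → Fin n → ℝ} {a b : ℝ}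
    (hg : ∀ i, IntervalIntegrable (fun t => g t i) volume a b) (i : Fin n) :
    (∫ t in a..b, g t) i = ∫ t in a..b, g t i := by
  simp only [intervalIntegral, Pi.sub_apply]
  rw [eval_integral fun i => (hg i).1, eval_integral fun i => (hg i).2]

lemma eq_zero_of_eq_integral_mulVec {C : ℝ} (hC : ∀ t i j, |A t i j| ≤ C) {a b : ℝ}
    {w : ℝ → Fin n → ℝ} (hwc : ∀ i, ContinuousOn (fun t => w t i) (Set.Icc a b))
    (hw : ∀ t ∈ Set.Icc a b, ∀ i, w t i = ∫ r in a..t, (A r).mulVec (w r) i) :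
    ∀ t ∈ Set.Icc a b, w t = 0 := by
  have hwc' : ContinuousOn w (Set.Icc a b) := continuousOn_pi.mpr hwc
  refine eq_zero_of_norm_le_mul_integral_norm (K := n * |C|) hwc' fun t ht => ?_
  have hsub : Set.uIcc a t ⊆ Set.Icc a b := by
    rw [Set.uIcc_of_le ht.1]
    exact Set.Icc_subset_Icc_right ht.2
  have hint : IntervalIntegrable (fun r => ‖w r‖) volume a t :=
    (hwc'.norm.mono hsub).intervalIntegrable
  rw [← intervalIntegral.integral_const_mul]
  refine (pi_norm_le_iff_of_nonneg
    (intervalIntegral.integral_nonneg ht.1 fun r _ => by positivity)).mpr fun i => ?_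
  rw [hw t ht i]
  refine intervalIntegral.norm_integral_le_of_norm_le ht.1
    (Filter.Eventually.of_forall fun r _ => ?_) (hint.const_mul _)
  calc ‖(A r).mulVec (w r) i‖ ≤ ∑ j, ‖A r i j * w r j‖ :=
        norm_sum_le Finset.univ fun j => A r i j * w r j
    _ ≤ ∑ _j : Fin n, |C| * ‖w r‖ := by
        refine Finset.sum_le_sum fun j _ => ?_
        rw [norm_mul]
        exact mul_le_mul ((hC r i j).trans (le_abs_self C)) (norm_le_pi_norm _ j)
          (norm_nonneg _) (abs_nonneg _)
    _ = n * |C| * ‖w r‖ := by simp [mul_assoc]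

lemma mul_eq_add_integral_of_eq_add_integral {u v p q : ℝ → ℝ} {a b : ℝ} (hab : a ≤ b)
    (hp : IntervalIntegrable p volume a b) (hq : IntervalIntegrable q volume a b)
    (hu : ∀ t ∈ Set.Icc a b, u t = u a + ∫ r in a..t, p r)
    (hv : ∀ t ∈ Set.Icc a b, v t = v a + ∫ r in a..t, q r) :
    u b * v b = u a * v a + ∫ r in a..b, (p r * v r + u r * q r) := by
  have hac : ∀ {g : ℝ → ℝ} (c : ℝ), IntervalIntegrable g volume a b →
      AbsolutelyContinuousOnInterval (fun t => c + ∫ r in a..t, g r) a b := fun c hg =>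
    (contDiffOn_const (c := c)).absolutelyContinuousOnInterval.fun_add
      (hg.absolutelyContinuousOnInterval_intervalIntegral Set.left_mem_uIcc)
  have key := (hac (u a) hp).integral_deriv_mul_eq_sub (hac (v a) hq)
  simp only [intervalIntegral.integral_same, add_zero] at key
  rw [← hu b ⟨hab, le_rfl⟩, ← hv b ⟨hab, le_rfl⟩] at key
  rw [← sub_eq_iff_eq_add', ← key]
  refine intervalIntegral.integral_congr_ae ?_
  filter_upwards [hp.ae_hasDerivAt_integral, hq.ae_hasDerivAt_integral] with r hpr hqr hr
  have hr' := Set.uIoc_subset_uIcc hr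
  rw [((hpr hr' a Set.left_mem_uIcc).const_add (u a)).deriv,
    ((hqr hr' a Set.left_mem_uIcc).const_add (v a)).deriv]
  rw [Set.uIcc_of_le hab] at hr'
  rw [← hu r hr', ← hv r hr']

variable {Φ : ℝ → ℝ → Matrix (Fin n) (Fin n) ℝ}

lemma fundamentalMatrix_mul {C : ℝ} (hAmeas : ∀ i j, Measurable fun t => A t i j)
    (hC : ∀ t i j, |A t i j| ≤ C)
    (hΦcont : ∀ s i j, Continuous fun t => Φ t s i j)
    (hΦeq : ∀ s t i j, Φ t s i j
        = (1 : Matrix (Fin n) (Fin n) ℝ) i j + ∫ r in s..t, (A r * Φ r s) i j)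
    {t m : ℝ} (hmt : m ≤ t) (s : ℝ) : Φ t m * Φ m s = Φ t s := by
  have hA : ∀ a b i j, IntervalIntegrable (fun t => A t i j) volume a b := fun a b i j =>
    intervalIntegrable_of_measurable_of_abs_le (hAmeas i j) (fun t => hC t i j) a b
  have hAΦ : ∀ s a b i j, IntervalIntegrable (fun r => (A r * Φ r s) i j) volume a b :=
    fun s a b i j => intervalIntegrable_mulVec_apply (hA a b) (w := fun r k => Φ r s k j)
      (fun k => (hΦcont s k j).continuousOn) i
  ext i k
  have hzero := eq_zero_of_eq_integral_mulVec hC (a := m) (b := t)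
    (w := fun t i => (Φ t m * Φ m s) i k - Φ t s i k)
    (fun i => by
      simp only [Matrix.mul_apply]
      exact ((continuous_finsetSum _ fun j _ => (hΦcont m i j).mul continuous_const).sub
        (hΦcont s i k)).continuousOn)
    (fun r _ i => by
      have h1 : Φ r s i k = Φ m s i k + ∫ q in m..r, (A q * Φ q s) i k := by
        rw [hΦeq s r, hΦeq s m, add_assoc,
          intervalIntegral.integral_add_adjacent_intervals (hAΦ s _ _ i k) (hAΦ s _ _ i k)]
      have h2 : (Φ r m * Φ m s) i k
          = Φ m s i k + ∫ q in m..r, (A q * (Φ q m * Φ m s)) i k := by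
        have : ∀ q, (A q * (Φ q m * Φ m s)) i k = ∑ j, (A q * Φ q m) i j * Φ m s j k :=
          fun q => by rw [← Matrix.mul_assoc, Matrix.mul_apply]
        simp only [this]
        rw [intervalIntegral.integral_finsetSum fun j _ => (hAΦ m _ _ i j).mul_const _]
        simp only [intervalIntegral.integral_mul_const]
        rw [Matrix.mul_apply]
        simp only [hΦeq m r, add_mul, Finset.sum_add_distrib]
        rw [← Matrix.mul_apply, one_mul]
      rw [h1, h2, add_sub_add_left_eq_sub, ← intervalIntegral.integral_sub]
      · refine intervalIntegral.integral_congr fun q _ => ?_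
        simp only [Matrix.mul_apply (M := A q), Matrix.mulVec, dotProduct, mul_sub,
          Finset.sum_sub_distrib]
      · simp only [← Matrix.mul_assoc]
        simp only [Matrix.mul_apply (N := Φ m s)]
        have := IntervalIntegrable.sum (μ := volume) (a := m) (b := r) Finset.univ
          (f := fun j q => (A q * Φ q m) i j * Φ m s j k)
          fun j _ => (hAΦ m _ _ i j).mul_const _
        simpa only [Finset.sum_fn] using this
      · exact hAΦ s _ _ i k)
    t ⟨hmt, le_rfl⟩
  exact sub_eq_zero.mp (congrFun hzero i)

lemma continuousOn_of_mul_eq_one {X Z : ℝ → Matrix (Fin n) (Fin n) ℝ} {S : Set ℝ}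
    (hX : ∀ i j, ContinuousOn (fun t => X t i j) S) (hXZ : ∀ t ∈ S, X t * Z t = 1)
    (i j : Fin n) : ContinuousOn (fun t => Z t i j) S := by
  have hX' : ContinuousOn X S := continuousOn_pi.mpr fun i => continuousOn_pi.mpr (hX i)
  have hdet : ∀ t ∈ S, (X t).det ≠ 0 := fun t ht =>
    (Matrix.isUnit_det_of_right_inverse (hXZ t ht)).ne_zero
  have hdetc : ContinuousOn (fun t => (X t).det) S :=
    (continuous_id.matrix_det).comp_continuousOn hX'
  have hadj : ContinuousOn (fun t => (X t).adjugate i j) S :=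
    ((continuous_id.matrix_adjugate).matrix_elem i j).comp_continuousOn hX'
  refine ((hdetc.inv₀ hdet).mul hadj).congr fun t ht => ?_
  simp only [← Matrix.inv_eq_right_inv (hXZ t ht), Matrix.inv_def, Ring.inverse_eq_inv',
    Matrix.smul_apply, smul_eq_mul, Pi.mul_apply, Pi.inv_apply]

end Caratheodory

/-- Variation of constants for linear Carathéodory ODEs: if `x` is continuous and satisfies
`x(t) = x(t₀) + ∫_{t₀}^{t} (A(s) x(s) + f(s)) ds` on `[t₀, t₁]`, then
`x(t) = Φ_A(t, t₀) x(t₀) + ∫_{t₀}^{t} Φ_A(t, s) f(s) ds` on `[t₀, t₁]`. -/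
theorem variation_of_constants
    (n : ℕ)
    (A : ℝ → Matrix (Fin n) (Fin n) ℝ)
    (hAmeas : ∀ i j, Measurable fun t => A t i j)
    (hAbdd : ∃ C : ℝ, ∀ t i j, |A t i j| ≤ C)
    (Φ : ℝ → ℝ → Matrix (Fin n) (Fin n) ℝ)
    (hΦcont : ∀ s i j, Continuous fun t => Φ t s i j)
    (hΦeq : ∀ s t i j, Φ t s i j
        = (1 : Matrix (Fin n) (Fin n) ℝ) i j + ∫ r in s..t, (A r * Φ r s) i j)
    (t₀ t₁ : ℝ) (ht : t₀ ≤ t₁)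
    (f : ℝ → Fin n → ℝ)
    (hfmeas : ∀ i, Measurable fun t => f t i)
    (hfint : ∀ i, IntervalIntegrable (fun t => f t i) volume t₀ t₁)
    (x : ℝ → Fin n → ℝ)
    (hxcont : ∀ i, Continuous fun t => x t i)
    (hx : ∀ t ∈ Set.Icc t₀ t₁,
      x t = x t₀ + ∫ s in t₀..t, ((A s).mulVec (x s) + f s)) :
    ∀ t ∈ Set.Icc t₀ t₁,
      x t = (Φ t t₀).mulVec (x t₀) + ∫ s in t₀..t, (Φ t s).mulVec (f s) := by
  obtain ⟨C, hC⟩ := hAbdd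
  have hA : ∀ a b i j, IntervalIntegrable (fun t => A t i j) volume a b := fun a b i j =>
    intervalIntegrable_of_measurable_of_abs_le (hAmeas i j) (fun t => hC t i j) a b
  have hsub : ∀ t ∈ Set.Icc t₀ t₁, Set.uIcc t₀ t ⊆ Set.Icc t₀ t₁ := fun t ht' => by
    rw [Set.uIcc_of_le ht'.1]
    exact Set.Icc_subset_Icc_right ht'.2
  have hfint' : ∀ t ∈ Set.Icc t₀ t₁, ∀ i, IntervalIntegrable (fun s => f s i) volume t₀ t :=
    fun t ht' i => (hfint i).mono_set ((hsub t ht').trans Set.Icc_subset_uIcc)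
  have hcoc : ∀ {t m : ℝ}, m ≤ t → ∀ s, Φ t m * Φ m s = Φ t s :=
    fundamentalMatrix_mul hAmeas hC hΦcont hΦeq
  have hone : ∀ s, Φ s s = 1 := fun s => by
    ext i j
    rw [hΦeq, intervalIntegral.integral_same, add_zero]
  have hXZ : ∀ s ∈ Set.Icc t₀ t₁, Φ s t₀ * Φ t₀ s = 1 := fun s hs => by rw [hcoc hs.1, hone]
  have hZc : ∀ i j, ContinuousOn (fun s => Φ t₀ s i j) (Set.Icc t₀ t₁) :=
    continuousOn_of_mul_eq_one (fun i j => (hΦcont t₀ i j).continuousOn) hXZ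
  have hZf : ∀ t ∈ Set.Icc t₀ t₁, ∀ i,
      IntervalIntegrable (fun s => (Φ t₀ s).mulVec (f s) i) volume t₀ t := fun t ht' =>
    intervalIntegrable_mulVec_apply_of_continuousOn (fun i j => (hZc i j).mono (hsub t ht'))
      (hfint' t ht')
  have hAX : ∀ a b i j, IntervalIntegrable (fun r => (A r * Φ r t₀) i j) volume a b :=
    fun a b i j => intervalIntegrable_mulVec_apply (hA a b) (w := fun r k => Φ r t₀ k j)
      (fun k => (hΦcont t₀ k j).continuousOn) i
  -- `Φ s t₀ *ᵥ v s` solves the same integral equation as `x`.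
  let v : ℝ → Fin n → ℝ := fun t i => x t₀ i + ∫ s in t₀..t, (Φ t₀ s).mulVec (f s) i
  have hv₀ : v t₀ = x t₀ := by
    ext i
    simp [v]
  have hvc : ∀ i, ContinuousOn (fun t => v t i) (Set.Icc t₀ t₁) := fun i => by
    have := intervalIntegral.continuousOn_primitive_interval' (hZf t₁ ⟨ht, le_rfl⟩ i)
      Set.left_mem_uIcc
    rw [Set.uIcc_of_le ht] at this
    exact continuousOn_const.add this
  have hyc : ∀ i, ContinuousOn (fun t => (Φ t t₀).mulVec (v t) i) (Set.Icc t₀ t₁) := fun i => by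
    simp only [Matrix.mulVec, dotProduct]
    exact continuousOn_finsetSum _ fun j _ => (hΦcont t₀ i j).continuousOn.mul (hvc j)
  have hAy : ∀ t ∈ Set.Icc t₀ t₁, ∀ i, IntervalIntegrable
      (fun s => (A s).mulVec ((Φ s t₀).mulVec (v s)) i) volume t₀ t := fun t ht' =>
    intervalIntegrable_mulVec_apply (hA t₀ t) fun i => (hyc i).mono (hsub t ht')
  have hAx : ∀ t i, IntervalIntegrable (fun s => (A s).mulVec (x s) i) volume t₀ t := fun t =>
    intervalIntegrable_mulVec_apply (hA t₀ t) fun i => (hxcont i).continuousOn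
  have hy : ∀ t ∈ Set.Icc t₀ t₁, ∀ i, (Φ t t₀).mulVec (v t) i
      = x t₀ i + ∫ s in t₀..t, ((A s).mulVec ((Φ s t₀).mulVec (v s)) i + f s i) := by
    intro t ht' i
    have hprod : ∀ j, Φ t t₀ i j * v t j = (1 : Matrix (Fin n) (Fin n) ℝ) i j * x t₀ j
        + ∫ s in t₀..t, ((A s * Φ s t₀) i j * v s j
          + Φ s t₀ i j * (Φ t₀ s).mulVec (f s) j) := fun j => by
      have := mul_eq_add_integral_of_eq_add_integral (u := fun t => Φ t t₀ i j)
        (v := fun t => v t j) ht'.1 (hAX t₀ t i j) (hZf t ht' j)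
        (fun s _ => by rw [hone]; exact hΦeq t₀ s i j) (fun s _ => by rw [hv₀])
      simpa only [hone, hv₀] using this
    have hprodint : ∀ j, IntervalIntegrable (fun s => (A s * Φ s t₀) i j * v s j
          + Φ s t₀ i j * (Φ t₀ s).mulVec (f s) j) volume t₀ t := fun j =>
      ((hAX t₀ t i j).mul_continuousOn ((hvc j).mono (hsub t ht'))).add
        ((hZf t ht' j).continuousOn_mul (hΦcont t₀ i j).continuousOn)
    calc (Φ t t₀).mulVec (v t) i = ∑ j, Φ t t₀ i j * v t j := rfl
      _ = (1 : Matrix (Fin n) (Fin n) ℝ).mulVec (x t₀) i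
          + ∫ s in t₀..t, ∑ j, ((A s * Φ s t₀) i j * v s j
            + Φ s t₀ i j * (Φ t₀ s).mulVec (f s) j) := by
          rw [intervalIntegral.integral_finsetSum fun j _ => hprodint j]
          simp only [hprod, Finset.sum_add_distrib]
          rfl
      _ = _ := by
          rw [Matrix.one_mulVec]
          congr 1
          refine intervalIntegral.integral_congr fun s hs => ?_
          simp only [Finset.sum_add_distrib]
          change (A s * Φ s t₀).mulVec (v s) i + (Φ s t₀).mulVec ((Φ t₀ s).mulVec (f s)) i = _
          rw [Matrix.mulVec_mulVec, hXZ s (hsub t ht' hs), Matrix.one_mulVec,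
            ← Matrix.mulVec_mulVec]
  have hxi : ∀ t ∈ Set.Icc t₀ t₁, ∀ i,
      x t i = x t₀ i + ∫ s in t₀..t, ((A s).mulVec (x s) i + f s i) := fun t ht' i => by
    rw [hx t ht', Pi.add_apply, intervalIntegral_apply]
    · rfl
    · exact fun i => (hAx t i).add (hfint' t ht' i)
  have hxy := eq_zero_of_eq_integral_mulVec hC (a := t₀) (b := t₁)
    (w := fun t => x t - (Φ t t₀).mulVec (v t))
    (fun i => (hxcont i).continuousOn.sub (hyc i))
    (fun t ht' i => by
      rw [Pi.sub_apply, hxi t ht' i, hy t ht' i, add_sub_add_left_eq_sub,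
        ← intervalIntegral.integral_sub ((hAx t i).add (hfint' t ht' i))
          ((hAy t ht' i).add (hfint' t ht' i))]
      refine intervalIntegral.integral_congr fun s _ => ?_
      simp only [Matrix.mulVec_sub, Pi.sub_apply, add_sub_add_right_eq_sub])
  intro t ht'
  have hΦf : ∀ s, (Φ t s).mulVec (f s) = (Φ t t₀).mulVec ((Φ t₀ s).mulVec (f s)) := fun s => by
    rw [Matrix.mulVec_mulVec, hcoc ht'.1]
  rw [sub_eq_zero.mp (hxy t ht')]
  have hv : v t = x t₀ + fun i => ∫ s in t₀..t, (Φ t₀ s).mulVec (f s) i := rfl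
  rw [hv, Matrix.mulVec_add]
  congr 1
  ext i
  simp only [hΦf]
  rw [intervalIntegral_apply (g := fun s => (Φ t t₀).mulVec ((Φ t₀ s).mulVec (f s)))
    (intervalIntegrable_mulVec_apply_of_continuousOn (A := fun _ => Φ t t₀)
      (fun _ _ => continuousOn_const) (hZf t ht'))]
  calc ∑ j, Φ t t₀ i j * ∫ s in t₀..t, (Φ t₀ s).mulVec (f s) j
      = ∫ s in t₀..t, ∑ j, Φ t t₀ i j * (Φ t₀ s).mulVec (f s) j := by
        rw [intervalIntegral.integral_finsetSum fun j _ => (hZf t ht' j).const_mul _]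
        simp only [intervalIntegral.integral_const_mul]
    _ = _ := rfl
end
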